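/- Let f : X → X be a continuous transformation of a compact metric space X with h_top(f) < +∞. Then for every φ ∈ C(X): P_top(f,φ) = max_{μ ∈ 𝒫(X)} { 𝔥_μ(f) + ∫ φ dμ } = max_{μ ∈ 𝒫_f(X)} { 𝔥_μ(f) + ∫ φ dμ }, both maxima being attained; moreover, every μ ∈ 𝒫(X) attaining the first maximum is f-invariant. -/

import Mathlib

open MeasureTheory Filter Topology

/-- `dynPn f φ n ε` is the supremum, over all `(n,ε)`-separated finite subsets `E` of
`X`, of `∑_{x ∈ E} exp (Sₙφ(x))`, where `Sₙφ(x) = ∑_{j=0}^{n} φ(f^j x)` and `E` is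
`(n,ε)`-separated when any two distinct points of `E` are `ε`-apart in some iterate
`f^j`, `0 ≤ j ≤ n`. -/
noncomputable def dynPn {X : Type*} [MetricSpace X] (f : X → X) (φ : C(X, ℝ))
    (n : ℕ) (ε : ℝ) : ℝ :=
  sSup { r : ℝ | ∃ E : Finset X,
    (∀ x ∈ E, ∀ z ∈ E, x ≠ z → ∃ j ≤ n, ε ≤ dist (f^[j] x) (f^[j] z)) ∧
    r = ∑ x ∈ E, Real.exp (∑ j ∈ Finset.range (n + 1), φ (f^[j] x)) }

/-- The topological pressure `P_top(f,φ)`, as the limit as `ε → 0⁺` (equivalently, by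
monotonicity in `ε`, the supremum over `ε > 0`) of `limsup_n (1/n) log dynPn f φ n ε`,
valued in `EReal`. -/
noncomputable def Ptop {X : Type*} [MetricSpace X] (f : X → X) (φ : C(X, ℝ)) : EReal :=
  ⨆ ε : { e : ℝ // 0 < e },
    Filter.atTop.limsup (fun n : ℕ => ((Real.log (dynPn f φ n (ε : ℝ)) / n : ℝ) : EReal))

/-- The entropy-like map `𝔥_μ(f) = inf_{φ ∈ C(X)} { P_top(f,φ) − ∫ φ dμ }`. -/
noncomputable def dynEnt {X : Type*} [MetricSpace X] [MeasurableSpace X]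
    (f : X → X) (μ : ProbabilityMeasure X) : EReal :=
  ⨅ φ : C(X, ℝ), (Ptop f φ - ((∫ x, φ x ∂(μ : Measure X) : ℝ) : EReal))

section Pressure

variable {X : Type*} [MetricSpace X] {f : X → X} {φ ψ : C(X, ℝ)}

/-- The exponential sums over separated sets whose supremum is `dynPn f φ n ε`. -/
def separatedSums (f : X → X) (φ : C(X, ℝ)) (n : ℕ) (ε : ℝ) : Set ℝ :=
  { r : ℝ | ∃ E : Finset X,
    (∀ x ∈ E, ∀ z ∈ E, x ≠ z → ∃ j ≤ n, ε ≤ dist (f^[j] x) (f^[j] z)) ∧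
    r = ∑ x ∈ E, Real.exp (∑ j ∈ Finset.range (n + 1), φ (f^[j] x)) }

theorem separatedSums_nonempty (n : ℕ) (ε : ℝ) : (separatedSums f φ n ε).Nonempty :=
  ⟨0, ∅, by simp⟩

theorem exists_card_le_of_separated [CompactSpace X] (hf : Continuous f) (n : ℕ) {ε : ℝ}
    (hε : 0 < ε) : ∃ N : ℕ, ∀ E : Finset X,
      (∀ x ∈ E, ∀ z ∈ E, x ≠ z → ∃ j ≤ n, ε ≤ dist (f^[j] x) (f^[j] z)) → E.card ≤ N := by
  let U : X → Set X := fun x => ⋂ j ∈ Finset.range (n + 1), {z | dist (f^[j] x) (f^[j] z) < ε / 2}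
  have hU : ∀ x, IsOpen (U x) := fun x => isOpen_biInter_finset fun j _ =>
    isOpen_lt (continuous_const.dist (hf.iterate j)) continuous_const
  have hxU : ∀ x, x ∈ U x := fun x => by simp [U, hε]
  obtain ⟨t, ht⟩ := isCompact_univ.elim_finite_subcover U hU
    (fun x _ => Set.mem_iUnion.2 ⟨x, hxU x⟩)
  have hc : ∀ z, ∃ x ∈ t, z ∈ U x := fun z => by simpa using ht (Set.mem_univ z)
  choose c hct hcU using hc
  refine ⟨t.card, fun E hE => Finset.card_le_card_of_injOn c (fun z _ => hct z) ?_⟩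
  intro x hx z hz hxz
  by_contra hne
  obtain ⟨j, hj, hd⟩ := hE x hx z hz hne
  have h1 : dist (f^[j] (c x)) (f^[j] x) < ε / 2 :=
    Set.mem_iInter₂.1 (hcU x) j (Finset.mem_range.2 (by omega))
  have h2 : dist (f^[j] (c x)) (f^[j] z) < ε / 2 := by
    rw [hxz]
    exact Set.mem_iInter₂.1 (hcU z) j (Finset.mem_range.2 (by omega))
  linarith [dist_triangle_left (f^[j] x) (f^[j] z) (f^[j] (c x))]

theorem abs_birkhoff_le [CompactSpace X] (f : X → X) (φ : C(X, ℝ)) (n : ℕ) (x : X) :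
    |∑ j ∈ Finset.range (n + 1), φ (f^[j] x)| ≤ (n + 1) * ‖φ‖ := by
  refine (Finset.abs_sum_le_sum_abs _ _).trans ?_
  refine (Finset.sum_le_card_nsmul _ _ ‖φ‖ fun j _ => φ.norm_coe_le_norm _).trans ?_
  simp

theorem bddAbove_separatedSums [CompactSpace X] (hf : Continuous f) (n : ℕ) {ε : ℝ}
    (hε : 0 < ε) : BddAbove (separatedSums f φ n ε) := by
  obtain ⟨N, hN⟩ := exists_card_le_of_separated hf n hε
  refine ⟨N * Real.exp ((n + 1) * ‖φ‖), ?_⟩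
  rintro _ ⟨E, hE, rfl⟩
  refine (Finset.sum_le_card_nsmul _ _ (Real.exp ((n + 1) * ‖φ‖)) fun x _ =>
    Real.exp_le_exp.2 ((le_abs_self _).trans (abs_birkhoff_le f φ n x))).trans ?_
  rw [nsmul_eq_mul]
  gcongr
  exact hN E hE

theorem sum_le_dynPn [CompactSpace X] (hf : Continuous f) {n : ℕ} {ε : ℝ} (hε : 0 < ε)
    {E : Finset X}
    (hE : ∀ x ∈ E, ∀ z ∈ E, x ≠ z → ∃ j ≤ n, ε ≤ dist (f^[j] x) (f^[j] z)) :
    ∑ x ∈ E, Real.exp (∑ j ∈ Finset.range (n + 1), φ (f^[j] x)) ≤ dynPn f φ n ε :=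
  le_csSup (bddAbove_separatedSums hf n hε) ⟨E, hE, rfl⟩

theorem dynPn_le {n : ℕ} {ε c : ℝ}
    (h : ∀ E : Finset X,
      (∀ x ∈ E, ∀ z ∈ E, x ≠ z → ∃ j ≤ n, ε ≤ dist (f^[j] x) (f^[j] z)) →
      ∑ x ∈ E, Real.exp (∑ j ∈ Finset.range (n + 1), φ (f^[j] x)) ≤ c) :
    dynPn f φ n ε ≤ c := by
  refine csSup_le (separatedSums_nonempty n ε) ?_
  rintro _ ⟨E, hE, rfl⟩
  exact h E hE

theorem exp_neg_le_dynPn [CompactSpace X] [Nonempty X] (hf : Continuous f) (n : ℕ) {ε : ℝ}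
    (hε : 0 < ε) : Real.exp (-((n + 1) * ‖φ‖)) ≤ dynPn f φ n ε := by
  obtain ⟨x⟩ := ‹Nonempty X›
  have h := sum_le_dynPn (φ := φ) hf (n := n) hε (E := {x}) (by simp)
  rw [Finset.sum_singleton] at h
  exact (Real.exp_le_exp.2 (neg_le_of_abs_le (abs_birkhoff_le f φ n x))).trans h

theorem dynPn_pos [CompactSpace X] [Nonempty X] (hf : Continuous f) (n : ℕ) {ε : ℝ}
    (hε : 0 < ε) : 0 < dynPn f φ n ε :=
  (Real.exp_pos _).trans_le (exp_neg_le_dynPn hf n hε)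

theorem log_dynPn_le_add [CompactSpace X] [Nonempty X] (hf : Continuous f) {n : ℕ} {ε C : ℝ}
    (hε : 0 < ε)
    (h : ∀ x, ∑ j ∈ Finset.range (n + 1), φ (f^[j] x) ≤
      ∑ j ∈ Finset.range (n + 1), ψ (f^[j] x) + C) :
    Real.log (dynPn f φ n ε) ≤ Real.log (dynPn f ψ n ε) + C := by
  have key : dynPn f φ n ε ≤ dynPn f ψ n ε * Real.exp C := by
    refine dynPn_le fun E hE => ?_
    refine le_trans ?_
      (mul_le_mul_of_nonneg_right (sum_le_dynPn (φ := ψ) hf hε hE) (Real.exp_pos C).le)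
    rw [Finset.sum_mul]
    refine Finset.sum_le_sum fun x _ => ?_
    rw [← Real.exp_add]
    exact Real.exp_le_exp.2 (h x)
  have := Real.log_le_log (dynPn_pos hf n hε) key
  rwa [Real.log_mul (dynPn_pos hf n hε).ne' (Real.exp_pos C).ne', Real.log_exp] at this

theorem log_dynPn_convex [CompactSpace X] [Nonempty X] (hf : Continuous f) (n : ℕ) {ε : ℝ}
    (hε : 0 < ε) {s t : ℝ} (hs : 0 ≤ s) (ht : 0 ≤ t) (hst : s + t = 1) :
    Real.log (dynPn f (s • φ + t • ψ) n ε) ≤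
      s * Real.log (dynPn f φ n ε) + t * Real.log (dynPn f ψ n ε) := by
  set A := Real.log (dynPn f φ n ε)
  set B := Real.log (dynPn f ψ n ε)
  have hA' : Real.exp A = dynPn f φ n ε := Real.exp_log (dynPn_pos hf n hε)
  have hB' : Real.exp B = dynPn f ψ n ε := Real.exp_log (dynPn_pos hf n hε)
  rw [Real.log_le_iff_le_exp (dynPn_pos hf n hε)]
  refine dynPn_le fun E hE => ?_
  have h1 := sum_le_dynPn (φ := φ) hf hε hE
  have h2 := sum_le_dynPn (φ := ψ) hf hε hE
  rw [← hA'] at h1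
  rw [← hB'] at h2
  set a : X → ℝ := fun x => ∑ j ∈ Finset.range (n + 1), φ (f^[j] x)
  set b : X → ℝ := fun x => ∑ j ∈ Finset.range (n + 1), ψ (f^[j] x)
  have hsum : ∀ x, ∑ j ∈ Finset.range (n + 1), (s • φ + t • ψ) (f^[j] x) = s * a x + t * b x := by
    intro x
    simp [a, b, Finset.sum_add_distrib, Finset.mul_sum]
  have hterm : ∀ x, Real.exp (s * a x + t * b x) ≤ Real.exp (s * A + t * B) *
      (s * (Real.exp (a x) * Real.exp (-A)) + t * (Real.exp (b x) * Real.exp (-B))) := by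
    intro x
    have hc := convexOn_exp.2 (Set.mem_univ (a x - A)) (Set.mem_univ (b x - B)) hs ht hst
    simp only [smul_eq_mul] at hc
    rw [← Real.exp_add, ← Real.exp_add, ← sub_eq_add_neg, ← sub_eq_add_neg]
    calc Real.exp (s * a x + t * b x)
        = Real.exp (s * A + t * B) * Real.exp (s * (a x - A) + t * (b x - B)) := by
          rw [← Real.exp_add]; congr 1; ring
      _ ≤ _ := by gcongr
  calc _ = ∑ x ∈ E, Real.exp (s * a x + t * b x) := Finset.sum_congr rfl fun x _ => by rw [hsum x]
    _ ≤ ∑ x ∈ E, Real.exp (s * A + t * B) *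
        (s * (Real.exp (a x) * Real.exp (-A)) + t * (Real.exp (b x) * Real.exp (-B))) :=
      Finset.sum_le_sum fun x _ => hterm x
    _ = Real.exp (s * A + t * B) * (s * ((∑ x ∈ E, Real.exp (a x)) * Real.exp (-A)) +
        t * ((∑ x ∈ E, Real.exp (b x)) * Real.exp (-B))) := by
      rw [← Finset.mul_sum, Finset.sum_add_distrib, ← Finset.mul_sum, ← Finset.mul_sum,
        ← Finset.sum_mul, ← Finset.sum_mul]
    _ ≤ Real.exp (s * A + t * B) * (s * (Real.exp A * Real.exp (-A)) +
        t * (Real.exp B * Real.exp (-B))) := by gcongr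
    _ = Real.exp (s * A + t * B) := by
      rw [← Real.exp_add, ← Real.exp_add, add_neg_cancel, add_neg_cancel, Real.exp_zero,
        mul_one, mul_one, hst, mul_one]

theorem Ptop_le_coe_iff {c : ℝ} :
    Ptop f φ ≤ (c : EReal) ↔ ∀ ε > 0, ∀ δ > 0, ∀ᶠ n : ℕ in atTop,
      Real.log (dynPn f φ n ε) / n ≤ c + δ := by
  rw [Ptop, iSup_le_iff, Subtype.forall]
  refine forall₂_congr fun ε hε => ⟨fun h δ hδ => ?_, fun h => ?_⟩
  · have hlt : ((c : ℝ) : EReal) < ((c + δ : ℝ) : EReal) := by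
      exact_mod_cast lt_add_of_pos_right c hδ
    filter_upwards [eventually_lt_of_limsup_lt (h.trans_lt hlt)] with n hn
    exact (EReal.coe_lt_coe_iff.1 hn).le
  · refine EReal.le_of_forall_lt_iff_le.1 fun z hz => ?_
    have hz' : c < z := EReal.coe_lt_coe_iff.1 hz
    refine limsup_le_of_le (h := ?_)
    filter_upwards [h (z - c) (sub_pos.2 hz')] with n hn
    exact EReal.coe_le_coe_iff.2 (by linarith)

theorem Ptop_le_of_birkhoff_le [CompactSpace X] [Nonempty X] (hf : Continuous f) {a b c : ℝ}
    (h : ∀ (n : ℕ) x, ∑ j ∈ Finset.range (n + 1), φ (f^[j] x) ≤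
      ∑ j ∈ Finset.range (n + 1), ψ (f^[j] x) + (n * a + b))
    (hψ : Ptop f ψ ≤ (c : EReal)) : Ptop f φ ≤ ((c + a : ℝ) : EReal) := by
  rw [Ptop_le_coe_iff] at hψ ⊢
  intro ε hε δ hδ
  have hlim : Tendsto (fun n : ℕ => b / (n : ℝ)) atTop (𝓝 0) :=
    tendsto_const_div_atTop_nhds_zero_nat b
  filter_upwards [hψ ε hε (δ / 2) (half_pos hδ), hlim.eventually (gt_mem_nhds (half_pos hδ)),
    eventually_gt_atTop 0] with n h1 h2 hn
  have hn' : (0 : ℝ) < n := by exact_mod_cast hn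
  have h3 := log_dynPn_le_add (φ := φ) (ψ := ψ) hf hε (h n)
  calc Real.log (dynPn f φ n ε) / n
      ≤ (Real.log (dynPn f ψ n ε) + (n * a + b)) / n := by gcongr
    _ = Real.log (dynPn f ψ n ε) / n + a + b / n := by field_simp; ring
    _ ≤ c + a + δ := by linarith

theorem Ptop_ne_bot [CompactSpace X] [Nonempty X] (hf : Continuous f) : Ptop f φ ≠ ⊥ := by
  intro h
  have h1 : Ptop f φ ≤ ((-(2 * ‖φ‖) - 2 : ℝ) : EReal) := h ▸ bot_le
  rw [Ptop_le_coe_iff] at h1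
  obtain ⟨n, hn, hn0⟩ := ((h1 1 one_pos 1 one_pos).and (eventually_gt_atTop 0)).exists
  have hn' : (1 : ℝ) ≤ n := by exact_mod_cast hn0
  have h2 : -((n + 1) * ‖φ‖) ≤ Real.log (dynPn f φ n 1) :=
    (Real.le_log_iff_exp_le (dynPn_pos hf n one_pos)).2 (exp_neg_le_dynPn hf n one_pos)
  rw [div_le_iff₀ (by linarith)] at hn
  nlinarith [norm_nonneg φ, mul_nonneg (sub_nonneg.2 hn') (norm_nonneg φ)]

theorem Ptop_ne_top [CompactSpace X] [Nonempty X] (hf : Continuous f) (htop : Ptop f 0 < ⊤) :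
    Ptop f φ ≠ ⊤ := by
  have h0 := EReal.coe_toReal htop.ne (Ptop_ne_bot hf)
  refine ((Ptop_le_of_birkhoff_le (ψ := 0) (a := ‖φ‖) (b := ‖φ‖) hf (fun n x => ?_)
    h0.ge).trans_lt (EReal.coe_lt_top _)).ne
  have := (le_abs_self _).trans (abs_birkhoff_le f φ n x)
  simp only [ContinuousMap.zero_apply, Finset.sum_const_zero]
  linarith

theorem coe_toReal_Ptop [CompactSpace X] [Nonempty X] (hf : Continuous f) (htop : Ptop f 0 < ⊤)
    (φ : C(X, ℝ)) : ((Ptop f φ).toReal : EReal) = Ptop f φ :=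
  EReal.coe_toReal (Ptop_ne_top hf htop) (Ptop_ne_bot hf)

theorem toReal_Ptop_le_of_birkhoff_le [CompactSpace X] [Nonempty X] (hf : Continuous f)
    (htop : Ptop f 0 < ⊤) {a b : ℝ}
    (h : ∀ (n : ℕ) x, ∑ j ∈ Finset.range (n + 1), φ (f^[j] x) ≤
      ∑ j ∈ Finset.range (n + 1), ψ (f^[j] x) + (n * a + b)) :
    (Ptop f φ).toReal ≤ (Ptop f ψ).toReal + a := by
  have := Ptop_le_of_birkhoff_le hf h (coe_toReal_Ptop hf htop ψ).ge
  rwa [← coe_toReal_Ptop hf htop, EReal.coe_le_coe_iff] at this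

theorem toReal_Ptop_le_add [CompactSpace X] [Nonempty X] (hf : Continuous f)
    (htop : Ptop f 0 < ⊤) {a : ℝ} (h : ∀ x, φ x ≤ ψ x + a) :
    (Ptop f φ).toReal ≤ (Ptop f ψ).toReal + a := by
  refine toReal_Ptop_le_of_birkhoff_le (b := a) hf htop fun n x => ?_
  refine (Finset.sum_le_sum fun j _ => h (f^[j] x)).trans_eq ?_
  rw [Finset.sum_add_distrib]
  simp
  ring

theorem toReal_Ptop_add_coboundary_le [CompactSpace X] [Nonempty X] (hf : Continuous f)
    (htop : Ptop f 0 < ⊤) (φ g : C(X, ℝ)) :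
    (Ptop f φ).toReal ≤ (Ptop f (φ + (g.comp ⟨f, hf⟩ - g))).toReal := by
  have : ∀ (n : ℕ) x, ∑ j ∈ Finset.range (n + 1), φ (f^[j] x) ≤
      ∑ j ∈ Finset.range (n + 1), (φ + (g.comp ⟨f, hf⟩ - g)) (f^[j] x) +
        (n * 0 + 2 * ‖g‖) := by
    intro n x
    have htel : ∑ j ∈ Finset.range (n + 1), (φ + (g.comp ⟨f, hf⟩ - g)) (f^[j] x) =
        ∑ j ∈ Finset.range (n + 1), φ (f^[j] x) + (g (f^[n + 1] x) - g x) := by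
      have := Finset.sum_range_sub (fun j => g (f^[j] x)) (n + 1)
      simp only [Function.iterate_zero, id_eq] at this
      rw [← this, ← Finset.sum_add_distrib]
      refine Finset.sum_congr rfl fun j _ => ?_
      simp [Function.iterate_succ_apply']
    rw [htel]
    have h1 := abs_le.1 (g.norm_coe_le_norm (f^[n + 1] x))
    have h2 := abs_le.1 (g.norm_coe_le_norm x)
    linarith [h1.1, h2.2]
  simpa using toReal_Ptop_le_of_birkhoff_le hf htop this

theorem convexOn_toReal_Ptop [CompactSpace X] [Nonempty X] (hf : Continuous f)
    (htop : Ptop f 0 < ⊤) : ConvexOn ℝ Set.univ fun φ : C(X, ℝ) => (Ptop f φ).toReal := by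
  refine ⟨convex_univ, fun φ _ ψ _ s t hs ht hst => ?_⟩
  rw [← EReal.coe_le_coe_iff, coe_toReal_Ptop hf htop, Ptop_le_coe_iff]
  intro ε hε δ hδ
  filter_upwards [Ptop_le_coe_iff.1 (coe_toReal_Ptop hf htop φ).ge ε hε δ hδ,
    Ptop_le_coe_iff.1 (coe_toReal_Ptop hf htop ψ).ge ε hε δ hδ] with n h1 h2
  calc Real.log (dynPn f (s • φ + t • ψ) n ε) / n
      ≤ (s * Real.log (dynPn f φ n ε) + t * Real.log (dynPn f ψ n ε)) / n := by
        gcongr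
        exact log_dynPn_convex hf n hε hs ht hst
    _ = s * (Real.log (dynPn f φ n ε) / n) + t * (Real.log (dynPn f ψ n ε) / n) := by ring
    _ ≤ s * ((Ptop f φ).toReal + δ) + t * ((Ptop f ψ).toReal + δ) := by gcongr
    _ = s • (Ptop f φ).toReal + t • (Ptop f ψ).toReal + δ := by
        simp only [smul_eq_mul]
        linear_combination δ * hst

theorem continuous_toReal_Ptop [CompactSpace X] [Nonempty X] (hf : Continuous f)
    (htop : Ptop f 0 < ⊤) : Continuous fun φ : C(X, ℝ) => (Ptop f φ).toReal := by
  refine (LipschitzWith.of_le_add fun φ ψ => ?_).continuous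
  refine toReal_Ptop_le_add hf htop fun x => ?_
  have := (le_abs_self _).trans
    ((Real.dist_eq _ _).ge.trans (ContinuousMap.dist_apply_le_dist (f := φ) (g := ψ) x))
  linarith

end Pressure

/-- A continuous convex function on a real normed space has a subgradient at every point. -/
theorem exists_subgradient {E : Type*} [NormedAddCommGroup E] [NormedSpace ℝ E] {p : E → ℝ}
    (hp : ConvexOn ℝ Set.univ p) (hc : Continuous p) (x : E) :
    ∃ Λ : E →L[ℝ] ℝ, ∀ y, p x + Λ (y - x) ≤ p y := by
  have hconv : Convex ℝ {q : E × ℝ | p q.1 < q.2} := by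
    simpa using hp.convex_strict_epigraph
  have hopen : IsOpen {q : E × ℝ | p q.1 < q.2} :=
    isOpen_lt (hc.comp continuous_fst) continuous_snd
  obtain ⟨F, hF⟩ := geometric_hahn_banach_open_point (x := (x, p x)) hconv hopen (by simp)
  set c := F (0, 1)
  have hsplit : ∀ y r, F (y, r) = F (y, 0) + r * c := by
    intro y r
    have : ((y, r) : E × ℝ) = (y, 0) + r • (0, 1) := by simp
    rw [this, map_add, map_smul, smul_eq_mul]
  have hneg : c < 0 := by
    have := hF (x, p x + 1) (by simp)
    rw [hsplit, hsplit x (p x)] at this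
    linarith
  have hle : ∀ y, F (y, 0) + p y * c ≤ F (x, 0) + p x * c := by
    intro y
    refine le_of_forall_pos_le_add fun δ hδ => ?_
    have hδc : 0 < δ / (-c) := div_pos hδ (neg_pos.2 hneg)
    have := hF (y, p y + δ / (-c)) (by simpa using hδc)
    rw [hsplit, hsplit x (p x)] at this
    have he : δ / (-c) * c = -δ := by
      rw [div_mul_eq_mul_div, div_neg, mul_div_cancel_right₀ _ hneg.ne]
    linarith
  refine ⟨(-c)⁻¹ • F.comp (ContinuousLinearMap.inl ℝ E ℝ), fun y => ?_⟩
  have h1 : F (y - x, 0) = F (y, 0) - F (x, 0) := by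
    rw [← map_sub]
    simp
  have h2 : (-c)⁻¹ * F (y - x, 0) ≤ p y - p x := by
    rw [inv_mul_le_iff₀ (neg_pos.2 hneg), h1]
    linarith [hle y]
  have h3 : ((-c)⁻¹ • F.comp (ContinuousLinearMap.inl ℝ E ℝ)) (y - x) =
      (-c)⁻¹ * F (y - x, 0) := rfl
  rw [h3]
  linarith

/-- A normalized positive linear functional on `C(X, ℝ)` is integration against a probability
measure. -/
theorem exists_probabilityMeasure_integral_eq {X : Type*} [TopologicalSpace X] [T2Space X]
    [CompactSpace X] [MeasurableSpace X] [BorelSpace X] (Λ : C(X, ℝ) →L[ℝ] ℝ)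
    (hpos : ∀ g : C(X, ℝ), 0 ≤ g → 0 ≤ Λ g) (hone : Λ 1 = 1) :
    ∃ μ : ProbabilityMeasure X, ∀ g : C(X, ℝ), ∫ x, g x ∂(μ : Measure X) = Λ g := by
  let L : CompactlySupportedContinuousMap X ℝ →ₚ[ℝ] ℝ := PositiveLinearMap.mk₀
    { toFun := fun g => Λ (g : C(X, ℝ))
      map_add' := fun g h => Λ.map_add (g : C(X, ℝ)) (h : C(X, ℝ))
      map_smul' := fun r g => Λ.map_smul r (g : C(X, ℝ)) } fun g hg => hpos (g : C(X, ℝ)) hg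
  have hintegral : ∀ g : C(X, ℝ), ∫ x, g x ∂(RealRMK.rieszMeasure L) = Λ g := fun g =>
    RealRMK.integral_rieszMeasure L (CompactlySupportedContinuousMap.continuousMapEquiv g)
  have hprob : IsProbabilityMeasure (RealRMK.rieszMeasure L) := by
    have h1 := hintegral 1
    rw [hone] at h1
    simp only [ContinuousMap.one_apply, integral_const, smul_eq_mul, mul_one] at h1
    constructor
    rwa [measureReal_def, ENNReal.toReal_eq_one_iff] at h1
  exact ⟨⟨_, hprob⟩, hintegral⟩

section Equilibrium

variable {X : Type*} [MetricSpace X] [MeasurableSpace X] {f : X → X}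

theorem dynEnt_add_integral_le [CompactSpace X] [Nonempty X] (hf : Continuous f)
    (htop : Ptop f 0 < ⊤) (φ : C(X, ℝ)) (μ : ProbabilityMeasure X) :
    dynEnt f μ + ((∫ x, φ x ∂(μ : Measure X) : ℝ) : EReal) ≤ Ptop f φ := by
  refine (add_le_add_left (iInf_le _ φ) _).trans_eq ?_
  rw [← coe_toReal_Ptop hf htop φ, ← EReal.coe_sub, ← EReal.coe_add, sub_add_cancel]

theorem dynEnt_add_integral_eq_iff [CompactSpace X] [Nonempty X] (hf : Continuous f)
    (htop : Ptop f 0 < ⊤) (φ : C(X, ℝ)) (μ : ProbabilityMeasure X) :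
    dynEnt f μ + ((∫ x, φ x ∂(μ : Measure X) : ℝ) : EReal) = Ptop f φ ↔
      ∀ ψ : C(X, ℝ), (Ptop f φ).toReal - ∫ x, φ x ∂(μ : Measure X) ≤
        (Ptop f ψ).toReal - ∫ x, ψ x ∂(μ : Measure X) := by
  rw [(dynEnt_add_integral_le hf htop φ μ).ge_iff_eq.symm,
    ← EReal.sub_le_iff_le_add (by simp) (by simp), dynEnt, le_iInf_iff]
  refine forall_congr' fun ψ => ?_
  rw [← coe_toReal_Ptop hf htop φ, ← coe_toReal_Ptop hf htop ψ, ← EReal.coe_sub, ← EReal.coe_sub,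
    EReal.coe_le_coe_iff]
  simp

theorem map_eq_of_dynEnt_add_integral_eq [CompactSpace X] [Nonempty X] [BorelSpace X]
    (hf : Continuous f) (htop : Ptop f 0 < ⊤) (φ : C(X, ℝ)) (μ : ProbabilityMeasure X)
    (h : dynEnt f μ + ((∫ x, φ x ∂(μ : Measure X) : ℝ) : EReal) = Ptop f φ) :
    (μ : Measure X).map f = (μ : Measure X) := by
  rw [dynEnt_add_integral_eq_iff hf htop] at h
  have hintegral : ∀ g : C(X, ℝ), Integrable g (μ : Measure X) := fun g =>
    g.continuous.integrable_of_hasCompactSupport (HasCompactSupport.of_compactSpace g)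
  have hle : ∀ g : C(X, ℝ), ∫ x, g x ∂(μ : Measure X) ≤ ∫ x, g (f x) ∂(μ : Measure X) := by
    intro g
    have h1 := toReal_Ptop_add_coboundary_le hf htop (φ - (g.comp ⟨f, hf⟩ - g)) g
    rw [sub_add_cancel] at h1
    have h2 := h (φ - (g.comp ⟨f, hf⟩ - g))
    have h3 : ∫ x, (φ - (g.comp ⟨f, hf⟩ - g)) x ∂(μ : Measure X) =
        ∫ x, φ x ∂(μ : Measure X) -
          (∫ x, g (f x) ∂(μ : Measure X) - ∫ x, g x ∂(μ : Measure X)) := by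
      have hgf : Integrable (fun x => g (f x)) (μ : Measure X) := hintegral (g.comp ⟨f, hf⟩)
      rw [← integral_sub hgf (hintegral g)]
      exact integral_sub (hintegral φ) (hgf.sub (hintegral g))
    linarith
  have hmap : IsProbabilityMeasure ((μ : Measure X).map f) :=
    Measure.isProbabilityMeasure_map hf.measurable.aemeasurable
  refine ext_of_forall_integral_eq_of_IsFiniteMeasure fun g => ?_
  rw [integral_map hf.measurable.aemeasurable g.continuous.aestronglyMeasurable]
  refine le_antisymm ?_ (hle g.toContinuousMap)
  have := hle (-g.toContinuousMap)
  simp only [ContinuousMap.neg_apply, integral_neg, neg_le_neg_iff] at this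
  exact this

theorem exists_dynEnt_add_integral_eq [CompactSpace X] [Nonempty X] [BorelSpace X]
    (hf : Continuous f) (htop : Ptop f 0 < ⊤) (φ : C(X, ℝ)) :
    ∃ μ : ProbabilityMeasure X,
      dynEnt f μ + ((∫ x, φ x ∂(μ : Measure X) : ℝ) : EReal) = Ptop f φ := by
  obtain ⟨Λ, hΛ⟩ := exists_subgradient (convexOn_toReal_Ptop hf htop)
    (continuous_toReal_Ptop hf htop) φ
  have hpert : ∀ (g : C(X, ℝ)) (a : ℝ), (∀ x, g x ≤ a) → Λ g ≤ a := by
    intro g a hg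
    have h1 := hΛ (φ + g)
    have h2 := toReal_Ptop_le_add (φ := φ + g) (ψ := φ) (a := a) hf htop
      fun x => by simpa using hg x
    rw [add_sub_cancel_left] at h1
    linarith
  have hpos : ∀ g : C(X, ℝ), 0 ≤ g → 0 ≤ Λ g := by
    intro g hg
    have := hpert (-g) 0 fun x => by simpa using hg x
    rwa [map_neg, neg_nonpos] at this
  have hone : Λ 1 = 1 := by
    refine le_antisymm (hpert 1 1 fun x => by simp) ?_
    have := hpert (-1) (-1) fun x => by simp
    rwa [map_neg, neg_le_neg_iff] at this
  obtain ⟨μ, hμ⟩ := exists_probabilityMeasure_integral_eq Λ hpos hone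
  refine ⟨μ, (dynEnt_add_integral_eq_iff hf htop φ μ).2 fun ψ => ?_⟩
  have := hΛ ψ
  rw [map_sub] at this
  rw [hμ, hμ]
  linarith

end Equilibrium

/-- For a continuous `f : X → X` on a compact metric space with finite
topological entropy and `φ ∈ C(X)`:
`P_top(f,φ) = max_{μ ∈ 𝒫(X)} { 𝔥_μ(f) + ∫ φ dμ } = max_{μ ∈ 𝒫_f(X)} { 𝔥_μ(f) + ∫ φ dμ }`,
both maxima being attained, and every maximizing measure is `f`-invariant. -/
theorem dyn_variational_principle {X : Type*} [MetricSpace X] [CompactSpace X]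
    [Nonempty X] [MeasurableSpace X] [BorelSpace X]
    (f : X → X) (hf : Continuous f) (htop : Ptop f 0 < ⊤) (φ : C(X, ℝ)) :
    (∃ μ : ProbabilityMeasure X,
        dynEnt f μ + ((∫ x, φ x ∂(μ : Measure X) : ℝ) : EReal) = Ptop f φ ∧
        ∀ ν : ProbabilityMeasure X,
          dynEnt f ν + ((∫ x, φ x ∂(ν : Measure X) : ℝ) : EReal) ≤ Ptop f φ) ∧
    (∃ μ : ProbabilityMeasure X, (μ : Measure X).map f = (μ : Measure X) ∧
        dynEnt f μ + ((∫ x, φ x ∂(μ : Measure X) : ℝ) : EReal) = Ptop f φ ∧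
        ∀ ν : ProbabilityMeasure X, (ν : Measure X).map f = (ν : Measure X) →
          dynEnt f ν + ((∫ x, φ x ∂(ν : Measure X) : ℝ) : EReal) ≤ Ptop f φ) ∧
    (∀ μ : ProbabilityMeasure X,
        dynEnt f μ + ((∫ x, φ x ∂(μ : Measure X) : ℝ) : EReal) = Ptop f φ →
        (μ : Measure X).map f = (μ : Measure X)) := by
  have hinv := map_eq_of_dynEnt_add_integral_eq hf htop φ
  obtain ⟨μ, hμ⟩ := exists_dynEnt_add_integral_eq hf htop φ
  have hle := dynEnt_add_integral_le hf htop φ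
  exact ⟨⟨μ, hμ, hle⟩, ⟨μ, hinv μ hμ, hμ, fun ν _ => hle ν⟩, hinv⟩
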